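/- There exists a constant C > 0 such that for all μ ∈ [0,1/2], all e₀ ∈ [0,1/2], all δ ∈ (0,1], and every solution q : [t₁,t₂] → ℝ² of the elliptic restricted three-body problem with ‖q(t) + μ·q₀(t)‖ ≥ δ and ‖q(t) − (1−μ)·q₀(t)‖ ≥ δ for all t ∈ [t₁,t₂], the Jacobi integral drifts at most at rate O(μ·e₀): |J(q(t₂), q̇(t₂), t₂) − J(q(t₁), q̇(t₁), t₁)| ≤ C·μ·e₀·δ^{−2}·(t₂ − t₁). -/

import Mathlib

/-- First component of the primaries' motion `q₀(t) = q_{e₀}(t)`. -/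
noncomputable def q01 (U : ℝ → ℝ → ℝ) (e0 t : ℝ) : ℝ := Real.cos (U e0 t) - e0

/-- Second component of the primaries' motion `q₀(t) = q_{e₀}(t)`. -/
noncomputable def q02 (U : ℝ → ℝ → ℝ) (e0 t : ℝ) : ℝ :=
  Real.sqrt (1 - e0 ^ 2) * Real.sin (U e0 t)

/-- Distance from the asteroid to the Sun (at `−μ·q₀(t)`), elliptic problem. -/
noncomputable def d1e (U : ℝ → ℝ → ℝ) (μ e0 : ℝ) (q1 q2 : ℝ → ℝ) (t : ℝ) : ℝ :=
  Real.sqrt ((q1 t + μ * q01 U e0 t) ^ 2 + (q2 t + μ * q02 U e0 t) ^ 2)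

/-- Distance from the asteroid to Jupiter (at `(1−μ)·q₀(t)`), elliptic problem. -/
noncomputable def d2e (U : ℝ → ℝ → ℝ) (μ e0 : ℝ) (q1 q2 : ℝ → ℝ) (t : ℝ) : ℝ :=
  Real.sqrt ((q1 t - (1 - μ) * q01 U e0 t) ^ 2 + (q2 t - (1 - μ) * q02 U e0 t) ^ 2)

/-- First component of the acceleration of the elliptic restricted three-body problem. -/
noncomputable def acc1 (U : ℝ → ℝ → ℝ) (μ e0 : ℝ) (q1 q2 : ℝ → ℝ) (t : ℝ) : ℝ :=
  -(1 - μ) * (q1 t + μ * q01 U e0 t) / d1e U μ e0 q1 q2 t ^ 3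
    - μ * (q1 t - (1 - μ) * q01 U e0 t) / d2e U μ e0 q1 q2 t ^ 3

/-- Second component of the acceleration of the elliptic restricted three-body problem. -/
noncomputable def acc2 (U : ℝ → ℝ → ℝ) (μ e0 : ℝ) (q1 q2 : ℝ → ℝ) (t : ℝ) : ℝ :=
  -(1 - μ) * (q2 t + μ * q02 U e0 t) / d1e U μ e0 q1 q2 t ^ 3
    - μ * (q2 t - (1 - μ) * q02 U e0 t) / d2e U μ e0 q1 q2 t ^ 3

/-- The Jacobi integral along a curve, for the elliptic problem. -/
noncomputable def JacE (U : ℝ → ℝ → ℝ) (μ e0 : ℝ) (q1 q2 v1 v2 : ℝ → ℝ) (t : ℝ) : ℝ :=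
  (v1 t ^ 2 + v2 t ^ 2) / 2 - (1 - μ) / d1e U μ e0 q1 q2 t - μ / d2e U μ e0 q1 q2 t
    - (q1 t * v2 t - q2 t * v1 t)

theorem aux_U_deriv (f : ℝ → ℝ) (e : ℝ) (he0 : 0 ≤ e) (he : e ≤ 1/2)
    (hf : ∀ t, f t - e * Real.sin (f t) = t) (t : ℝ) :
    HasDerivAt f (1 - e * Real.cos (f t))⁻¹ t := by
  have hlip : ∀ a b, |f a - f b| ≤ 2 * |a - b| := by
    intro a b
    have h1 := hf a
    have h2 := hf b
    have h3 : |Real.sin (f a) - Real.sin (f b)| ≤ |f a - f b| := by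
      have := Real.lipschitzWith_sin.dist_le_mul (f a) (f b)
      simpa [Real.dist_eq] using this
    have h4 : |f a - f b| ≤ |a - b| + e * |Real.sin (f a) - Real.sin (f b)| := by
      calc |f a - f b| = |(a - b) + e * (Real.sin (f a) - Real.sin (f b))| := by
            congr 1; linarith
        _ ≤ |a - b| + |e * (Real.sin (f a) - Real.sin (f b))| := abs_add_le _ _
        _ = _ := by rw [abs_mul, abs_of_nonneg he0]
    have h5 := mul_le_mul he h3 (abs_nonneg _) (by norm_num)
    linarith
  have hc : ContinuousAt f t := by
    have : LipschitzWith 2 f := LipschitzWith.of_dist_le_mul (by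
      intro a b; simpa [Real.dist_eq] using hlip a b)
    exact this.continuous.continuousAt
  have hg : HasDerivAt (fun u => u - e * Real.sin u) (1 - e * Real.cos (f t)) (f t) :=
    (hasDerivAt_id' (f t)).sub ((Real.hasDerivAt_sin (f t)).const_mul e)
  refine HasDerivAt.of_local_left_inverse hc hg ?_ (Filter.Eventually.of_forall hf)
  have := Real.cos_le_one (f t)
  nlinarith

theorem aux_inv_deriv (X Y : ℝ → ℝ) (X' Y' c : ℝ) (s : Set ℝ) (t : ℝ)
    (hX : HasDerivWithinAt X X' s t) (hY : HasDerivWithinAt Y Y' s t)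
    (hr : 0 < Real.sqrt (X t ^ 2 + Y t ^ 2)) :
    HasDerivWithinAt (fun t => c / Real.sqrt (X t ^ 2 + Y t ^ 2))
      (-c * (X t * X' + Y t * Y') / Real.sqrt (X t ^ 2 + Y t ^ 2) ^ 3) s t := by
  have h1 := (((hX.pow 2).add (hY.pow 2)).sqrt (Real.sqrt_pos.1 hr).ne')
  have h2 := (hasDerivWithinAt_const t s c).div h1 hr.ne'
  refine h2.congr_deriv ?_
  simp only [Pi.add_apply, Pi.pow_apply]
  field_simp
  ring

theorem aux_w (e u s k : ℝ) (he0 : 0 ≤ e) (he : e ≤ 1/2) (hs : s = Real.sqrt (1 - e ^ 2))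
    (hk : k = (1 - e * Real.cos u)⁻¹) :
    |-(Real.sin u) * k + s * Real.sin u| ≤ 3 * e ∧
    |s * (Real.cos u * k) - (Real.cos u - e)| ≤ 4 * e := by
  have hc1 := Real.cos_le_one u
  have hc2 := Real.neg_one_le_cos u
  have hs1 : s ≤ 1 := by rw [hs]; exact Real.sqrt_le_one.2 (by nlinarith)
  have hs2 : 1 - e ≤ s := by rw [hs]; exact Real.le_sqrt_of_sq_le (by nlinarith)
  have hden : 0 < 1 - e * Real.cos u := by nlinarith
  have hk' : k * (1 - e * Real.cos u) = 1 := by rw [hk]; exact inv_mul_cancel₀ hden.ne'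
  have hkpos : 0 < k := by rw [hk]; positivity
  have hk2 : k ≤ 2 := by nlinarith
  have hkd : |k - 1| ≤ 2 * e := by
    have : k - 1 = k * (e * Real.cos u) := by linarith
    rw [this, abs_mul, abs_mul, abs_of_pos hkpos, abs_of_nonneg he0]
    have := Real.abs_cos_le_one u
    have h3 : e * |Real.cos u| ≤ e := by nlinarith
    have h4 : 0 ≤ e * |Real.cos u| := by positivity
    nlinarith
  obtain ⟨hk3, hk4⟩ := abs_le.1 hkd
  have hA : |s - k| ≤ 3 * e := abs_le.2 ⟨by linarith, by linarith⟩
  have hB : |s * k - 1| ≤ 3 * e := by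
    have h5 : s * k - 1 = s * (k - 1) + (s - 1) := by ring
    have hs0 : 0 ≤ s := by linarith
    rw [h5]
    refine abs_le.2 ⟨by nlinarith, by nlinarith⟩
  constructor
  · have : -(Real.sin u) * k + s * Real.sin u = Real.sin u * (s - k) := by ring
    rw [this, abs_mul]
    have := Real.abs_sin_le_one u
    nlinarith [abs_nonneg (s - k)]
  · have h6 : s * (Real.cos u * k) - (Real.cos u - e) = Real.cos u * (s * k - 1) + e := by ring
    rw [h6]
    have h7 := abs_add_le (Real.cos u * (s * k - 1)) e
    rw [abs_mul, abs_of_nonneg he0] at h7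
    have := Real.abs_cos_le_one u
    nlinarith [abs_nonneg (s * k - 1)]

theorem aux_force (x y w1 w2 e δ : ℝ) (he : 0 ≤ e) (hδ : 0 < δ)
    (h : δ ≤ Real.sqrt (x ^ 2 + y ^ 2)) (h1 : |w1| ≤ 3 * e) (h2 : |w2| ≤ 4 * e) :
    |(x * w1 + y * w2) / Real.sqrt (x ^ 2 + y ^ 2) ^ 3| ≤ 7 * e * δ⁻¹ ^ 2 := by
  set r := Real.sqrt (x ^ 2 + y ^ 2) with hr
  have hr0 : 0 < r := hδ.trans_le h
  have hx : |x| ≤ r := Real.abs_le_sqrt (by nlinarith [sq_nonneg y])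
  have hy : |y| ≤ r := Real.abs_le_sqrt (by nlinarith [sq_nonneg x])
  have hn : |x * w1 + y * w2| ≤ 7 * e * r := by
    have h3 := abs_add_le (x * w1) (y * w2)
    rw [abs_mul, abs_mul] at h3
    have h4 := mul_le_mul hx h1 (abs_nonneg _) hr0.le
    have h5 := mul_le_mul hy h2 (abs_nonneg _) hr0.le
    linarith
  rw [abs_div, abs_of_pos (pow_pos hr0 3)]
  calc _ ≤ 7 * e * r / r ^ 3 := by gcongr
    _ = 7 * e * r⁻¹ ^ 2 := by field_simp
    _ ≤ _ := by gcongr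

/-- There is a constant `C > 0` such that for all
`μ ∈ [0,1/2]`, `e₀ ∈ [0,1/2]`, `δ ∈ (0,1]`, and every solution of the elliptic
restricted three-body problem on `[t₁,t₂]` staying at distance `≥ δ` from both
primaries, the Jacobi integral drifts at most at rate `O(μ·e₀·δ⁻²)`:
`|J(t₂) − J(t₁)| ≤ C·μ·e₀·δ⁻²·(t₂ − t₁)`. -/
theorem stmt_14 (U : ℝ → ℝ → ℝ)
    (hU : ∀ e ∈ Set.Ico (0:ℝ) 1, ∀ ℓ : ℝ, U e ℓ - e * Real.sin (U e ℓ) = ℓ) :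
    ∃ C > 0, ∀ μ ∈ Set.Icc (0:ℝ) (1/2), ∀ e0 ∈ Set.Icc (0:ℝ) (1/2),
      ∀ δ ∈ Set.Ioc (0:ℝ) 1, ∀ t₁ t₂ : ℝ, t₁ ≤ t₂ →
      ∀ q1 q2 v1 v2 : ℝ → ℝ,
      (∀ t ∈ Set.Icc t₁ t₂, δ ≤ d1e U μ e0 q1 q2 t ∧ δ ≤ d2e U μ e0 q1 q2 t) →
      (∀ t ∈ Set.Icc t₁ t₂,
        HasDerivWithinAt q1 (v1 t) (Set.Icc t₁ t₂) t ∧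
        HasDerivWithinAt q2 (v2 t) (Set.Icc t₁ t₂) t ∧
        HasDerivWithinAt v1 (acc1 U μ e0 q1 q2 t) (Set.Icc t₁ t₂) t ∧
        HasDerivWithinAt v2 (acc2 U μ e0 q1 q2 t) (Set.Icc t₁ t₂) t) →
      |JacE U μ e0 q1 q2 v1 v2 t₂ - JacE U μ e0 q1 q2 v1 v2 t₁|
        ≤ C * μ * e0 * δ⁻¹ ^ 2 * (t₂ - t₁) := by
  refine ⟨14, by norm_num, ?_⟩
  rintro μ ⟨hμ0, hμ1⟩ e0 ⟨he0, he1⟩ δ ⟨hδ0, hδ1⟩ t₁ t₂ ht q1 q2 v1 v2 hd hsol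
  have hUd := aux_U_deriv (U e0) e0 he0 he1 (hU e0 ⟨he0, by linarith⟩)
  set S := Set.Icc t₁ t₂ with hS
  let k : ℝ → ℝ := fun t => (1 - e0 * Real.cos (U e0 t))⁻¹
  let s : ℝ := Real.sqrt (1 - e0 ^ 2)
  let p1' : ℝ → ℝ := fun t => -(Real.sin (U e0 t)) * k t
  let p2' : ℝ → ℝ := fun t => s * (Real.cos (U e0 t) * k t)
  have hp1 : ∀ t, HasDerivWithinAt (q01 U e0) (p1' t) S t := fun t =>
    ((hUd t).cos.sub_const e0).hasDerivWithinAt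
  have hp2 : ∀ t, HasDerivWithinAt (q02 U e0) (p2' t) S t := fun t =>
    ((hUd t).sin.const_mul s).hasDerivWithinAt
  let w1 : ℝ → ℝ := fun t => p1' t + q02 U e0 t
  let w2 : ℝ → ℝ := fun t => p2' t - q01 U e0 t
  let F : ℝ → ℝ := fun t => μ * (1 - μ) *
    (((q1 t + μ * q01 U e0 t) * w1 t + (q2 t + μ * q02 U e0 t) * w2 t) / d1e U μ e0 q1 q2 t ^ 3
    - ((q1 t - (1 - μ) * q01 U e0 t) * w1 t + (q2 t - (1 - μ) * q02 U e0 t) * w2 t)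
      / d2e U μ e0 q1 q2 t ^ 3)
  have hderiv : ∀ t ∈ S, HasDerivWithinAt (JacE U μ e0 q1 q2 v1 v2) (F t) S t := by
    intro t htS
    obtain ⟨h1, h2, h3, h4⟩ := hsol t htS
    obtain ⟨hd1, hd2⟩ := hd t htS
    have hd1' : 0 < d1e U μ e0 q1 q2 t := hδ0.trans_le hd1
    have hd2' : 0 < d2e U μ e0 q1 q2 t := hδ0.trans_le hd2
    have hA := aux_inv_deriv (fun t => q1 t + μ * q01 U e0 t) (fun t => q2 t + μ * q02 U e0 t)
      _ _ (1 - μ) S t (h1.add ((hp1 t).const_mul μ)) (h2.add ((hp2 t).const_mul μ)) hd1'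
    have hB := aux_inv_deriv (fun t => q1 t - (1 - μ) * q01 U e0 t)
      (fun t => q2 t - (1 - μ) * q02 U e0 t)
      _ _ μ S t (h1.sub ((hp1 t).const_mul (1 - μ))) (h2.sub ((hp2 t).const_mul (1 - μ))) hd2'
    have hJ := (((((h3.pow 2).add (h4.pow 2)).div_const 2).sub hA).sub hB).sub
      ((h1.mul h4).sub (h2.mul h3))
    refine HasDerivWithinAt.congr_deriv (f := JacE U μ e0 q1 q2 v1 v2) hJ ?_
    change _ = μ * (1 - μ) *
      (((q1 t + μ * q01 U e0 t) * (p1' t + q02 U e0 t)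
        + (q2 t + μ * q02 U e0 t) * (p2' t - q01 U e0 t)) / d1e U μ e0 q1 q2 t ^ 3
      - ((q1 t - (1 - μ) * q01 U e0 t) * (p1' t + q02 U e0 t)
        + (q2 t - (1 - μ) * q02 U e0 t) * (p2' t - q01 U e0 t)) / d2e U μ e0 q1 q2 t ^ 3)
    simp only [acc1, acc2]
    simp only [← d1e.eq_1, ← d2e.eq_1]
    generalize d1e U μ e0 q1 q2 t = r1 at *
    generalize d2e U μ e0 q1 q2 t = r2 at *
    simp only [div_eq_mul_inv]
    push_cast
    ring
  have hbound : ∀ t ∈ S, ‖F t‖ ≤ 14 * μ * e0 * δ⁻¹ ^ 2 := by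
    intro t htS
    obtain ⟨hd1, hd2⟩ := hd t htS
    obtain ⟨hw1, hw2⟩ := aux_w e0 (U e0 t) s (k t) he0 he1 rfl rfl
    have hA := aux_force _ _ (w1 t) (w2 t) e0 δ he0 hδ0 hd1 hw1 hw2
    have hB := aux_force _ _ (w1 t) (w2 t) e0 δ he0 hδ0 hd2 hw1 hw2
    have hAB := (abs_sub _ _).trans (add_le_add hA hB)
    have hm : 0 ≤ μ * (1 - μ) := mul_nonneg hμ0 (by linarith)
    have hm2 : μ * (1 - μ) ≤ μ := by nlinarith
    rw [Real.norm_eq_abs]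
    change |μ * (1 - μ) * _| ≤ _
    rw [abs_mul, abs_of_nonneg hm]
    refine (mul_le_mul hm2 hAB (abs_nonneg _) hμ0).trans (le_of_eq ?_)
    ring
  have hmv := Convex.norm_image_sub_le_of_norm_hasDerivWithin_le hderiv hbound (convex_Icc t₁ t₂)
    (Set.left_mem_Icc.2 ht) (Set.right_mem_Icc.2 ht)
  rw [Real.norm_eq_abs, Real.norm_eq_abs, abs_of_nonneg (sub_nonneg.2 ht)] at hmv
  exact hmv
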